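/- Consider a dynamically nontrivial (n,m,n−1) mass action network (rank Γ = n−1) which is not P_f-overdetermined and satisfies n ≤ m ≤ n + p_f − 1. Then p_f = m − n + 1, s_{P_f} = n−1, and rank [A | 1_{P_f}] = m (the sources are P_f-independent). Further: (i) for every κ ∈ ℝ^m_+ and K ∈ ℝ, the set of nondegenerate equilibria in E_κ ∩ S_K has at most n elements; (ii) if there exists ω ∈ ker Γ^⊤ ∩ ℝ^n_{≥0} \ {0}, then this set has at most 2 elements; (iii) if there exists such ω and the single column Q̂ of a toricity matrix for P_f can be chosen so that Q̂_i ≥ 0 whenever ω_i ≠ 0, then this set has at most 1 element. -/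

import Mathlib

open Matrix

noncomputable section

/-- Entrywise power of a vector by a real exponent matrix:
`(powVec M x) i = ∏ j, (x j) ^ (M i j)` (real powers). -/
def powVec {k l : ℕ} (M : Matrix (Fin k) (Fin l) ℝ) (x : Fin l → ℝ) : Fin k → ℝ :=
  fun i => ∏ j, x j ^ M i j

/-- Cast an integer matrix to a real matrix. -/
def mR {a b : ℕ} (M : Matrix (Fin a) (Fin b) ℤ) : Matrix (Fin a) (Fin b) ℝ :=
  M.map fun t => (t : ℝ)

/-- The (open) positive orthant. -/
def posOrth (k : ℕ) : Set (Fin k → ℝ) :=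
  {x | ∀ i, 0 < x i}

/-- The mass action vector field `g_κ(x) = Γ (κ ∘ x^A)`. -/
def massAction {n m : ℕ} (Γ : Matrix (Fin n) (Fin m) ℤ) (A : Matrix (Fin m) (Fin n) ℤ)
    (κ : Fin m → ℝ) (x : Fin n → ℝ) : Fin n → ℝ :=
  (mR Γ).mulVec (κ * powVec (mR A) x)

/-- The positive equilibrium set `E_κ`. -/
def Eset {n m : ℕ} (Γ : Matrix (Fin n) (Fin m) ℤ) (A : Matrix (Fin m) (Fin n) ℤ)
    (κ : Fin m → ℝ) : Set (Fin n → ℝ) :=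
  {x | (∀ i, 0 < x i) ∧ massAction Γ A κ x = 0}

/-- The Jacobian matrix `Γ D_{κ∘x^A} A D_{1/x}` of `g_κ` at `x`. -/
def jacMat {n m : ℕ} (Γ : Matrix (Fin n) (Fin m) ℤ) (A : Matrix (Fin m) (Fin n) ℤ)
    (κ : Fin m → ℝ) (x : Fin n → ℝ) : Matrix (Fin n) (Fin n) ℝ :=
  mR Γ * Matrix.diagonal (κ * powVec (mR A) x) * mR A * Matrix.diagonal (fun i => (x i)⁻¹)

/-- Nondegeneracy of an equilibrium: `ker J_{g_κ}(x) ∩ im Γ = {0}`. -/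
def nondegAt {n m : ℕ} (Γ : Matrix (Fin n) (Fin m) ℤ) (A : Matrix (Fin m) (Fin n) ℤ)
    (κ : Fin m → ℝ) (x : Fin n → ℝ) : Prop :=
  ∀ z : Fin n → ℝ, (jacMat Γ A κ x).mulVec z = 0 → (∃ v, (mR Γ).mulVec v = z) → z = 0

/-- Strong degeneracy of the network: every positive equilibrium has Jacobian of
rank less than `rank Γ`, for every choice of rate constants. -/
def stronglyDegenerate {n m : ℕ} (Γ : Matrix (Fin n) (Fin m) ℤ)
    (A : Matrix (Fin m) (Fin n) ℤ) : Prop :=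
  ∀ κ ∈ posOrth m, ∀ x ∈ Eset Γ A κ, (jacMat Γ A κ x).rank < (mR Γ).rank

/-- Dynamically nontrivial: the positive flux cone `ker Γ ∩ ℝ^m_+` is nonempty. -/
def dynNontrivial {n m : ℕ} (Γ : Matrix (Fin n) (Fin m) ℤ) : Prop :=
  ∃ v : Fin m → ℝ, (mR Γ).mulVec v = 0 ∧ ∀ j, 0 < v j

/-- `ker Γ` factors over the partition of `{1,…,m}` given by the fibres of `blk`. -/
def factorsOver {n m p : ℕ} (Γ : Matrix (Fin n) (Fin m) ℤ) (blk : Fin m → Fin p) : Prop :=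
  ∀ v : Fin m → ℝ, (mR Γ).mulVec v = 0 →
    ∀ i : Fin p, (mR Γ).mulVec (fun j => if blk j = i then v j else 0) = 0

/-- The matrix `[A | 1_P]`. -/
def srcMat {n m p : ℕ} (A : Matrix (Fin m) (Fin n) ℤ) (blk : Fin m → Fin p) :
    Matrix (Fin m) (Fin (n + p)) ℝ :=
  Matrix.of fun j => Fin.append (fun k => (A j k : ℝ)) (fun i => if blk j = i then 1 else 0)

/-- The first `n` rows of an `(n+p)×k` matrix. -/
def topRows (n p : ℕ) {k : ℕ} (M : Matrix (Fin (n + p)) (Fin k) ℝ) :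
    Matrix (Fin n) (Fin k) ℝ :=
  Matrix.of fun i j => M (Fin.castAdd p i) j

/-- The flux-cone parameterisation `(1_P λ) ∘ h(α)`. -/
def fluxParam {m p d : ℕ} (blk : Fin m → Fin p) (h : (Fin d → ℝ) → (Fin m → ℝ))
    (lam : Fin p → ℝ) (α : Fin d → ℝ) : Fin m → ℝ :=
  fun j => lam (blk j) * h α j

/-- Admissible cross-section parameterisation of the positive flux cone:
`Y` is an open bounded convex set (an open polytope), `h` is affine and injective,
depends blockwise on the coordinates of `Y`, and `(λ, α) ↦ (1_P λ) ∘ h(α)` is a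
bijection from `ℝ^p_+ × Y` onto the positive flux cone. -/
def admissibleH {n m p d : ℕ} (Γ : Matrix (Fin n) (Fin m) ℤ) (blk : Fin m → Fin p)
    (Y : Set (Fin d → ℝ)) (h : (Fin d → ℝ) → (Fin m → ℝ)) : Prop :=
  IsOpen Y ∧ Convex ℝ Y ∧ Bornology.IsBounded Y ∧ Y.Nonempty ∧
  (∃ (L : (Fin d → ℝ) →ₗ[ℝ] (Fin m → ℝ)) (c : Fin m → ℝ), ∀ α, h α = L α + c) ∧
  (∃ bY : Fin d → Fin p, ∀ (α α' : Fin d → ℝ) (j : Fin m),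
      (∀ t, bY t = blk j → α t = α' t) → h α j = h α' j) ∧
  (∀ (lam : Fin p → ℝ) (α : Fin d → ℝ), (∀ i, 0 < lam i) → α ∈ Y →
      (mR Γ).mulVec (fluxParam blk h lam α) = 0 ∧ ∀ j, 0 < fluxParam blk h lam α j) ∧
  (∀ v : Fin m → ℝ, (mR Γ).mulVec v = 0 → (∀ j, 0 < v j) →
      ∃ (lam : Fin p → ℝ) (α : Fin d → ℝ), (∀ i, 0 < lam i) ∧ α ∈ Y ∧
        v = fluxParam blk h lam α) ∧
  (∀ (lam lam' : Fin p → ℝ) (α α' : Fin d → ℝ), (∀ i, 0 < lam i) → (∀ i, 0 < lam' i) →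
      α ∈ Y → α' ∈ Y → fluxParam blk h lam α = fluxParam blk h lam' α' →
      lam = lam' ∧ α = α')

/-- The solvability variety `A_κ = {α ∈ Y : h(α)^W = κ^W}`. -/
def Aset {m d w : ℕ} (W : Matrix (Fin w) (Fin m) ℝ) (Y : Set (Fin d → ℝ))
    (h : (Fin d → ℝ) → (Fin m → ℝ)) (κ : Fin m → ℝ) : Set (Fin d → ℝ) :=
  {α ∈ Y | powVec W (h α) = powVec W κ}

/-- The rows of `W` form a basis of `ker [A|1_P]ᵀ`. -/
def isSolvabilityMatrix {n m p w : ℕ} (A : Matrix (Fin m) (Fin n) ℤ) (blk : Fin m → Fin p)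
    (W : Matrix (Fin w) (Fin m) ℝ) : Prop :=
  W * srcMat A blk = 0 ∧ W.rank = w ∧ w + (srcMat A blk).rank = m

/-- The columns of `Q` form a basis of `ker [A|1_P]`. -/
def isKernelMatrix {n m p q : ℕ} (A : Matrix (Fin m) (Fin n) ℤ) (blk : Fin m → Fin p)
    (Q : Matrix (Fin (n + p)) (Fin q) ℝ) : Prop :=
  srcMat A blk * Q = 0 ∧ Q.rank = q ∧ (srcMat A blk).rank + q = n + p

/-- `G` is a generalised inverse of `[A|1_P]`. -/
def isGenInv {n m p : ℕ} (A : Matrix (Fin m) (Fin n) ℤ) (blk : Fin m → Fin p)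
    (G : Matrix (Fin (n + p)) (Fin m) ℝ) : Prop :=
  srcMat A blk * G * srcMat A blk = srcMat A blk

/-- The parameterising map `F_κ(α,μ) = (h(α)/κ)^Ĝ ∘ μ^Q̂`. -/
def Fmap {n m p d q : ℕ} (G : Matrix (Fin (n + p)) (Fin m) ℝ)
    (Q : Matrix (Fin (n + p)) (Fin q) ℝ)
    (h : (Fin d → ℝ) → (Fin m → ℝ)) (κ : Fin m → ℝ) :
    (Fin d → ℝ) × (Fin q → ℝ) → (Fin n → ℝ) :=
  fun z => powVec (topRows n p G) (h z.1 / κ) * powVec (topRows n p Q) z.2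


theorem rolle_finset (g g' : ℝ → ℝ) (hg : ∀ t, HasDerivAt g (g' t) t) (k : ℕ) (Z : Finset ℝ)
    (hZ : Z.card = k + 1) (h0 : ∀ t ∈ Z, g t = 0) :
    ∃ Z' : Finset ℝ, Z'.card = k ∧ ∀ t ∈ Z', g' t = 0 := by
  let e := Z.orderEmbOfFin hZ
  have he : ∀ i, g (e i) = 0 := fun i => h0 _ (Finset.orderEmbOfFin_mem Z hZ i)
  have hex : ∀ i : Fin k, ∃ c ∈ Set.Ioo (e i.castSucc) (e i.succ), g' c = 0 := by
    intro i
    apply exists_hasDerivAt_eq_zero (f := g)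
    · exact e.strictMono Fin.castSucc_lt_succ
    · exact fun t _ => (hg t).continuousAt.continuousWithinAt
    · rw [he, he]
    · exact fun t _ => hg t
  choose c hc hc0 using hex
  have hmono : StrictMono c := by
    intro i j hij
    have h1 : e i.succ ≤ e j.castSucc := e.monotone (by
      rw [Fin.le_def]; simp; exact hij)
    exact lt_of_lt_of_le (hc i).2 (h1.trans (hc j).1.le)
  refine ⟨Finset.univ.image c, ?_, ?_⟩
  · rw [Finset.card_image_of_injective _ hmono.injective]; simp
  · intro t ht
    obtain ⟨i, _, rfl⟩ := Finset.mem_image.1 ht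
    exact hc0 i

theorem expsum_zero {ι : Type} [DecidableEq ι] (s : Finset ι) :
    ∀ (c a : ι → ℝ) (Z : Finset ℝ), s.card ≤ Z.card →
      (∀ t ∈ Z, ∑ i ∈ s, c i * Real.exp (a i * t) = 0) →
      ∀ t, ∑ i ∈ s, c i * Real.exp (a i * t) = 0 := by
  induction s using Finset.induction_on with
  | empty => intro c a Z _ _ t; simp
  | insert i0 s hi ih =>
    intro c a Z hZ h0
    rw [Finset.card_insert_of_notMem hi] at hZ
    obtain ⟨Z1, hZ1, hZ1c⟩ := Finset.exists_subset_card_eq hZ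
    let g : ℝ → ℝ := fun t => c i0 + ∑ i ∈ s, c i * Real.exp ((a i - a i0) * t)
    let g' : ℝ → ℝ := fun t => ∑ i ∈ s, (c i * (a i - a i0)) * Real.exp ((a i - a i0) * t)
    have hgf : ∀ t, ∑ i ∈ insert i0 s, c i * Real.exp (a i * t) = Real.exp (a i0 * t) * g t := by
      intro t
      rw [Finset.sum_insert hi]
      simp only [g, mul_add, Finset.mul_sum]
      congr 1
      · ring
      · refine Finset.sum_congr rfl fun i _ => ?_
        rw [mul_left_comm, ← Real.exp_add]
        have : a i0 * t + (a i - a i0) * t = a i * t := by ring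
        rw [this]
    have hg : ∀ t, HasDerivAt g (g' t) t := by
      intro t
      refine HasDerivAt.const_add _ (HasDerivAt.fun_sum (u := s)
        (A := fun i t => c i * Real.exp ((a i - a i0) * t))
        (A' := fun i => (c i * (a i - a i0)) * Real.exp ((a i - a i0) * t)) ?_)
      intro i _
      have h1 : HasDerivAt (fun t : ℝ => (a i - a i0) * t) (a i - a i0) t := by
        simpa using (hasDerivAt_id t).const_mul (a i - a i0)
      have h2 := (h1.exp).const_mul (c i)
      have h3 : c i * (a i - a i0) * Real.exp ((a i - a i0) * t)
          = c i * (Real.exp ((a i - a i0) * t) * (a i - a i0)) := by ring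
      simp only [h3]
      exact h2
    have hg0 : ∀ t ∈ Z1, g t = 0 := by
      intro t ht
      have := h0 t (hZ1 ht)
      rw [hgf] at this
      exact (mul_eq_zero.1 this).resolve_left (Real.exp_ne_zero _)
    obtain ⟨Z', hZ'c, hZ'0⟩ := rolle_finset g g' hg s.card Z1 hZ1c hg0
    have hall := ih (fun i => c i * (a i - a i0)) (fun i => a i - a i0) Z' hZ'c.ge hZ'0
    have hconst : ∀ x y, g x = g y :=
      is_const_of_deriv_eq_zero (fun t => (hg t).differentiableAt)
        (fun t => (hg t).deriv.trans (hall t))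
    obtain ⟨t0, ht0⟩ : Z1.Nonempty := by
      rw [← Finset.card_pos]; omega
    intro t
    rw [hgf, hconst t t0, hg0 t0 ht0, mul_zero]

theorem srcMat_mulVec {n m p : ℕ} (A : Matrix (Fin m) (Fin n) ℤ) (blk : Fin m → Fin p)
    (w : Fin (n + p) → ℝ) (j : Fin m) :
    (srcMat A blk).mulVec w j =
      ∑ i, (A j i : ℝ) * w (Fin.castAdd p i) + w (Fin.natAdd n (blk j)) := by
  simp [Matrix.mulVec, dotProduct, srcMat, Fin.sum_univ_add]

theorem im_of_dot {n m : ℕ} (Γ : Matrix (Fin n) (Fin m) ℤ) (hrank : (mR Γ).rank + 1 = n)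
    (ω : Fin n → ℝ) (hω : Matrix.vecMul ω (mR Γ) = 0) (hω0 : ω ≠ 0)
    (w : Fin n → ℝ) (hw : ω ⬝ᵥ w = 0) : ∃ v, (mR Γ).mulVec v = w := by
  let φ : (Fin n → ℝ) →ₗ[ℝ] ℝ := dotProductBilin ℝ ℝ ω
  have hφ : ∀ w, φ w = ω ⬝ᵥ w := fun w => rfl
  have hφ0 : φ ≠ 0 := by
    intro h
    apply hω0
    have := hφ ω
    rw [h] at this
    exact dotProduct_self_eq_zero.1 this.symm
  have hle : LinearMap.range (mR Γ).mulVecLin ≤ LinearMap.ker φ := by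
    rintro _ ⟨v, rfl⟩
    rw [LinearMap.mem_ker, hφ, Matrix.mulVecLin_apply, Matrix.dotProduct_mulVec, hω,
      zero_dotProduct]
  have h1 := Module.Dual.finrank_ker_add_one_of_ne_zero (f := φ) hφ0
  rw [Module.finrank_fin_fun] at h1
  have heq := Submodule.eq_of_le_of_finrank_eq hle (by
    have : Module.finrank ℝ (LinearMap.range (mR Γ).mulVecLin) = (mR Γ).rank := rfl
    rw [this]
    have h2 : Module.finrank ℝ (LinearMap.ker φ) + 1 = n := h1
    omega)
  have : w ∈ LinearMap.range (mR Γ).mulVecLin := by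
    rw [heq]; exact hw
  exact this

theorem flux_a {n m p : ℕ} (Γ : Matrix (Fin n) (Fin m) ℤ) (blk : Fin m → Fin p)
    (hfac : factorsOver Γ blk) (v : Fin m → ℝ) (hv : (mR Γ).mulVec v = 0) (l : Fin p → ℝ) :
    (mR Γ).mulVec (fun j => l (blk j) * v j) = 0 := by
  have : (fun j => l (blk j) * v j) = ∑ i, l i • (fun j => if blk j = i then v j else 0) := by
    ext j
    simp [Finset.sum_apply]
  rw [this, Matrix.mulVec_sum]
  refine Finset.sum_eq_zero fun i _ => ?_
  rw [Matrix.mulVec_smul, hfac v hv i, smul_zero]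

theorem flux_b {n m p : ℕ} (Γ : Matrix (Fin n) (Fin m) ℤ) (blk : Fin m → Fin p)
    (hblk : Function.Surjective blk) (hdim : (mR Γ).rank + p = m)
    (hfac : factorsOver Γ blk) (v : Fin m → ℝ) (hv : (mR Γ).mulVec v = 0) (hpos : ∀ j, 0 < v j)
    (w : Fin m → ℝ) (hw : (mR Γ).mulVec w = 0) :
    ∃ l : Fin p → ℝ, ∀ j, w j = l (blk j) * v j := by
  let Φ : (Fin p → ℝ) →ₗ[ℝ] (Fin m → ℝ) :=
    { toFun := fun l j => l (blk j) * v j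
      map_add' := by intro a b; ext j; simp [add_mul]
      map_smul' := by intro a b; ext j; simp [mul_assoc] }
  have hΦ : Function.Injective Φ := by
    intro a b hab
    ext i
    obtain ⟨j, rfl⟩ := hblk i
    exact mul_right_cancel₀ (hpos j).ne' (congrFun hab j)
  have hle : LinearMap.range Φ ≤ LinearMap.ker (mR Γ).mulVecLin := by
    rintro _ ⟨l, rfl⟩
    exact flux_a Γ blk hfac v hv l
  have h1 := LinearMap.finrank_range_of_inj hΦ
  have h2 := LinearMap.finrank_range_add_finrank_ker (mR Γ).mulVecLin
  have h3 : Module.finrank ℝ (LinearMap.range (mR Γ).mulVecLin) = (mR Γ).rank := rfl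
  rw [Module.finrank_fin_fun] at h1 h2
  have heq := Submodule.eq_of_le_of_finrank_eq hle (by omega)
  have : w ∈ LinearMap.range Φ := by rw [heq]; exact hw
  obtain ⟨l, hl⟩ := this
  exact ⟨l, fun j => (congrFun hl j).symm⟩

theorem powVec_pos {k l : ℕ} (M : Matrix (Fin k) (Fin l) ℝ) (x : Fin l → ℝ) (hx : ∀ i, 0 < x i)
    (j : Fin k) : 0 < powVec M x j :=
  Finset.prod_pos fun i _ => Real.rpow_pos_of_pos (hx i) _

theorem log_powVec {k l : ℕ} (M : Matrix (Fin k) (Fin l) ℝ) (x : Fin l → ℝ) (hx : ∀ i, 0 < x i)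
    (j : Fin k) : Real.log (powVec M x j) = ∑ i, M j i * Real.log (x i) := by
  unfold powVec
  rw [Real.log_prod (fun i _ => (Real.rpow_pos_of_pos (hx i) _).ne')]
  exact Finset.sum_congr rfl fun i _ => Real.log_rpow (hx i) _

theorem equil_line {n m p : ℕ} (Γ : Matrix (Fin n) (Fin m) ℤ) (A : Matrix (Fin m) (Fin n) ℤ)
    (blk : Fin m → Fin p)
    (hblk : Function.Surjective blk) (hdim : (mR Γ).rank + p = m)
    (hfac : factorsOver Γ blk) (hker : (srcMat A blk).rank + 1 = n + p)
    (qv : Fin (n + p) → ℝ) (hq : (srcMat A blk).mulVec qv = 0) (hq0 : qv ≠ 0)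
    (κ : Fin m → ℝ) (hκ : κ ∈ posOrth m) (x y : Fin n → ℝ) (hx : x ∈ Eset Γ A κ)
    (hy : y ∈ Eset Γ A κ) :
    ∃ t : ℝ, ∀ i, y i = x i * Real.exp (qv (Fin.castAdd p i) * t) := by
  obtain ⟨hx0, hxE⟩ := hx
  obtain ⟨hy0, hyE⟩ := hy
  have hvpos : ∀ j, 0 < (κ * powVec (mR A) x) j := fun j => mul_pos (hκ j) (powVec_pos _ _ hx0 j)
  obtain ⟨l, hl⟩ := flux_b Γ blk hblk hdim hfac _ hxE hvpos _ hyE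
  have hl' : ∀ j, powVec (mR A) y j = l (blk j) * powVec (mR A) x j := by
    intro j
    have := hl j
    simp only [Pi.mul_apply] at this
    have hk := (hκ j).ne'
    apply mul_left_cancel₀ hk
    rw [this]; ring
  have hlpos : ∀ j, 0 < l (blk j) := by
    intro j
    have h1 := powVec_pos (mR A) y hy0 j
    rw [hl' j] at h1
    exact pos_of_mul_pos_left h1 (powVec_pos (mR A) x hx0 j).le
  let w : Fin (n + p) → ℝ :=
    Fin.append (fun i => Real.log (y i) - Real.log (x i)) (fun i => - Real.log (l i))
  have hw : (srcMat A blk).mulVec w = 0 := by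
    ext j
    rw [srcMat_mulVec]
    simp only [w, Fin.append_left, Fin.append_right, Pi.zero_apply, mul_sub,
      Finset.sum_sub_distrib]
    have h1 := log_powVec (mR A) y hy0 j
    have h2 := log_powVec (mR A) x hx0 j
    rw [hl' j, Real.log_mul (hlpos j).ne' (powVec_pos (mR A) x hx0 j).ne'] at h1
    simp only [mR, Matrix.map_apply] at h1 h2
    linarith
  have hfr : Module.finrank ℝ (LinearMap.ker (srcMat A blk).mulVecLin) = 1 := by
    have h2 := LinearMap.finrank_range_add_finrank_ker (srcMat A blk).mulVecLin
    have h3 : Module.finrank ℝ (LinearMap.range (srcMat A blk).mulVecLin)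
      = (srcMat A blk).rank := rfl
    rw [Module.finrank_fin_fun] at h2
    omega
  obtain ⟨t, ht⟩ := (finrank_eq_one_iff_of_nonzero'
    (⟨qv, hq⟩ : LinearMap.ker (srcMat A blk).mulVecLin)
    (fun h => hq0 (congrArg Subtype.val h))).1 hfr ⟨w, hw⟩
  have ht' : t • qv = w := congrArg Subtype.val ht
  refine ⟨t, fun i => ?_⟩
  have := congrFun ht' (Fin.castAdd p i)
  simp only [w, Fin.append_left, Pi.smul_apply, smul_eq_mul] at this
  rw [mul_comm (qv _), this, Real.exp_sub, Real.exp_log (hy0 i), Real.exp_log (hx0 i)]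
  have := (hx0 i).ne'
  field_simp

theorem nondeg_deriv {n m p : ℕ} (Γ : Matrix (Fin n) (Fin m) ℤ) (A : Matrix (Fin m) (Fin n) ℤ)
    (blk : Fin m → Fin p)
    (hblk : Function.Surjective blk) (hrank : (mR Γ).rank + 1 = n)
    (hfac : factorsOver Γ blk)
    (qv : Fin (n + p) → ℝ) (hq : (srcMat A blk).mulVec qv = 0) (hq0 : qv ≠ 0)
    (κ : Fin m → ℝ) (x : Fin n → ℝ) (hx : x ∈ Eset Γ A κ)
    (hnd : nondegAt Γ A κ x)
    (ω : Fin n → ℝ) (hω : Matrix.vecMul ω (mR Γ) = 0) (hω0 : ω ≠ 0) :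
    ∑ i, ω i * x i * qv (Fin.castAdd p i) ≠ 0 := by
  intro h
  obtain ⟨hx0, hxE⟩ := hx
  have hq' : ∀ j, ∑ i, (A j i : ℝ) * qv (Fin.castAdd p i) = - qv (Fin.natAdd n (blk j)) := by
    intro j
    have := congrFun hq j
    rw [srcMat_mulVec] at this
    simp only [Pi.zero_apply] at this
    linarith
  have hw := hnd (fun i => x i * qv (Fin.castAdd p i)) ?_ ?_
  · have hq1 : ∀ i, qv (Fin.castAdd p i) = 0 := fun i =>
      (mul_eq_zero.1 (congrFun hw i)).resolve_left (hx0 i).ne'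
    apply hq0
    ext i
    refine Fin.addCases hq1 (fun k => ?_) i
    obtain ⟨j, rfl⟩ := hblk k
    have := hq' j
    simp only [hq1, mul_zero, Finset.sum_const_zero] at this
    simpa using this.symm
  · unfold jacMat
    rw [← Matrix.mulVec_mulVec, ← Matrix.mulVec_mulVec, ← Matrix.mulVec_mulVec]
    have e1 : (Matrix.diagonal fun i => (x i)⁻¹).mulVec (fun i => x i * qv (Fin.castAdd p i))
        = fun i => qv (Fin.castAdd p i) := by
      ext i
      rw [Matrix.mulVec_diagonal]
      have := (hx0 i).ne'
      field_simp
    have e2 : (mR A).mulVec (fun i => qv (Fin.castAdd p i))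
        = fun j => - qv (Fin.natAdd n (blk j)) := by
      ext j
      exact hq' j
    rw [e1, e2]
    have e3 : (Matrix.diagonal (κ * powVec (mR A) x)).mulVec
        (fun j => - qv (Fin.natAdd n (blk j)))
        = fun j => (fun k => - qv (Fin.natAdd n k)) (blk j) * (κ * powVec (mR A) x) j := by
      ext j
      rw [Matrix.mulVec_diagonal, mul_comm]
    rw [e3]
    exact flux_a Γ blk hfac _ hxE (fun k => - qv (Fin.natAdd n k))
  · apply im_of_dot Γ hrank ω hω hω0
    rw [← h]
    exact Finset.sum_congr rfl fun i _ => by ring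

theorem tangent_le {n : ℕ} (ω x y q : Fin n → ℝ) (t : ℝ) (hω : ∀ i, 0 ≤ ω i) (hx : ∀ i, 0 < x i)
    (hy : ∀ i, y i = x i * Real.exp (q i * t)) (he : ω ⬝ᵥ y = ω ⬝ᵥ x) :
    t * ∑ i, ω i * x i * q i ≤ 0 := by
  have h1 : ∑ i, (ω i * x i + t * (ω i * x i * q i)) ≤ ω ⬝ᵥ y := by
    refine Finset.sum_le_sum fun i _ => ?_
    rw [hy i]
    have h2 := Real.add_one_le_exp (q i * t)
    have h3 : 0 ≤ ω i * x i := mul_nonneg (hω i) (hx i).le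
    nlinarith [mul_le_mul_of_nonneg_left h2 h3]
  rw [Finset.sum_add_distrib, ← Finset.mul_sum, he] at h1
  have : ω ⬝ᵥ x = ∑ i, ω i * x i := rfl
  linarith

theorem dot_eq {n m : ℕ} (Γ : Matrix (Fin n) (Fin m) ℤ) (hrank : (mR Γ).rank + 1 = n)
    (z ω : Fin n → ℝ) (hz : Matrix.vecMul z (mR Γ) = 0) (hz0 : z ≠ 0)
    (hω : Matrix.vecMul ω (mR Γ) = 0) (x y : Fin n → ℝ) (h : z ⬝ᵥ y = z ⬝ᵥ x) :
    ω ⬝ᵥ y = ω ⬝ᵥ x := by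
  obtain ⟨v, hv⟩ := im_of_dot Γ hrank z hz hz0 (y - x) (by rw [dotProduct_sub, h, sub_self])
  have : ω ⬝ᵥ (y - x) = 0 := by
    rw [← hv, Matrix.dotProduct_mulVec, hω, zero_dotProduct]
  rw [dotProduct_sub] at this
  linarith

theorem part_i {n m p : ℕ} (Γ : Matrix (Fin n) (Fin m) ℤ) (A : Matrix (Fin m) (Fin n) ℤ)
    (blk : Fin m → Fin p)
    (z : Fin n → ℝ) (qv : Fin (n + p) → ℝ) (κ : Fin m → ℝ) (K : ℝ)
    (hline : ∀ x y, x ∈ Eset Γ A κ → y ∈ Eset Γ A κ →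
      ∃ t : ℝ, ∀ i, y i = x i * Real.exp (qv (Fin.castAdd p i) * t))
    (hder : ∀ x ∈ Eset Γ A κ, nondegAt Γ A κ x → ∑ i, z i * x i * qv (Fin.castAdd p i) ≠ 0)
    (T : Finset (Fin n → ℝ))
    (hT : ↑T ⊆ {x | x ∈ Eset Γ A κ ∧ z ⬝ᵥ x = K ∧ nondegAt Γ A κ x}) : T.card ≤ n := by
  by_contra hcard
  push Not at hcard
  obtain ⟨x, hxT⟩ : T.Nonempty := by rw [← Finset.card_pos]; omega
  obtain ⟨hxE, hxK, hxn⟩ := hT hxT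
  have : ∀ y, ∃ t : ℝ, y ∈ T → ∀ i, y i = x i * Real.exp (qv (Fin.castAdd p i) * t) := by
    intro y
    by_cases hy : y ∈ T
    · obtain ⟨t, ht⟩ := hline x y hxE (hT hy).1
      exact ⟨t, fun _ => ht⟩
    · exact ⟨0, fun h => absurd h hy⟩
  choose τ hτ using this
  have hinj : Set.InjOn τ T := by
    intro y hy y' hy' h
    ext i
    rw [hτ y hy i, hτ y' hy' i, h]
  have key := expsum_zero (Finset.univ : Finset (Option (Fin n)))
    (fun o => o.elim (-K) (fun i => z i * x i)) (fun o => o.elim 0 (fun i => qv (Fin.castAdd p i)))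
    (T.image τ) (by rw [Finset.card_image_of_injOn hinj]; simp; omega) (by
      intro t ht
      obtain ⟨y, hy, rfl⟩ := Finset.mem_image.1 ht
      rw [Fintype.sum_option]
      have h1 : z ⬝ᵥ y = K := (hT hy).2.1
      simp only [Option.elim, zero_mul, Real.exp_zero, mul_one]
      rw [← h1, neg_add_eq_zero]
      refine Finset.sum_congr rfl fun i _ => ?_
      rw [mul_assoc, ← hτ y hy i])
  apply hder x hxE hxn
  have hd : HasDerivAt (fun t : ℝ => ∑ i, z i * x i * Real.exp (qv (Fin.castAdd p i) * t))
      (∑ i, z i * x i * qv (Fin.castAdd p i)) 0 := by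
    apply HasDerivAt.fun_sum
    intro i _
    have h1 : HasDerivAt (fun t : ℝ => qv (Fin.castAdd p i) * t) (qv (Fin.castAdd p i)) 0 := by
      simpa using (hasDerivAt_id (0 : ℝ)).const_mul (qv (Fin.castAdd p i))
    have h2 := (h1.exp).const_mul (z i * x i)
    simpa using h2
  have hc : (fun t : ℝ => ∑ i, z i * x i * Real.exp (qv (Fin.castAdd p i) * t)) = fun _ => K := by
    ext t
    have := key t
    rw [Fintype.sum_option] at this
    simp only [Option.elim, zero_mul, Real.exp_zero, mul_one] at this
    linarith
  rw [hc] at hd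
  exact hd.unique (hasDerivAt_const _ _)

theorem part_iii {n m p : ℕ} (Γ : Matrix (Fin n) (Fin m) ℤ) (A : Matrix (Fin m) (Fin n) ℤ)
    (blk : Fin m → Fin p)
    (z ω : Fin n → ℝ) (qv : Fin (n + p) → ℝ) (κ : Fin m → ℝ) (K : ℝ)
    (hline : ∀ x y, x ∈ Eset Γ A κ → y ∈ Eset Γ A κ →
      ∃ t : ℝ, ∀ i, y i = x i * Real.exp (qv (Fin.castAdd p i) * t))
    (hder : ∀ x ∈ Eset Γ A κ, nondegAt Γ A κ x → ∑ i, ω i * x i * qv (Fin.castAdd p i) ≠ 0)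
    (hdot : ∀ x y, z ⬝ᵥ y = z ⬝ᵥ x → ω ⬝ᵥ y = ω ⬝ᵥ x) (hω : ∀ i, 0 ≤ ω i)
    (hsgn : ∀ i : Fin n, ω i ≠ 0 → 0 ≤ qv (Fin.castAdd p i))
    (T : Finset (Fin n → ℝ))
    (hT : ↑T ⊆ {x | x ∈ Eset Γ A κ ∧ z ⬝ᵥ x = K ∧ nondegAt Γ A κ x}) : T.card ≤ 1 := by
  rw [Finset.card_le_one]
  intro x hx y hy
  obtain ⟨hxE, hxK, hxn⟩ := hT hx
  obtain ⟨hyE, hyK, hyn⟩ := hT hy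
  have hpos : ∀ x ∈ Eset Γ A κ, nondegAt Γ A κ x →
      0 < ∑ i, ω i * x i * qv (Fin.castAdd p i) := by
    intro x hx hn
    refine lt_of_le_of_ne (Finset.sum_nonneg fun i _ => ?_) (hder x hx hn).symm
    by_cases h : ω i = 0
    · simp [h]
    · exact mul_nonneg (mul_nonneg (hω i) (hx.1 i).le) (hsgn i h)
  obtain ⟨t, ht⟩ := hline x y hxE hyE
  have ht' : ∀ i, x i = y i * Real.exp (qv (Fin.castAdd p i) * (-t)) := by
    intro i
    rw [ht i, mul_assoc, ← Real.exp_add]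
    simp
  have h1 := tangent_le ω x y _ t hω hxE.1 ht (hdot x y (hyK.trans hxK.symm))
  have h2 := tangent_le ω y x _ (-t) hω hyE.1 ht' (hdot y x (hxK.trans hyK.symm))
  have p1 := hpos x hxE hxn
  have p2 := hpos y hyE hyn
  have t0 : t = 0 := by
    apply le_antisymm
    · exact nonpos_of_mul_nonpos_left h1 p1
    · have := nonpos_of_mul_nonpos_left h2 p2
      linarith
  ext i
  rw [ht i, t0]
  simp

theorem part_ii {n m p : ℕ} (Γ : Matrix (Fin n) (Fin m) ℤ) (A : Matrix (Fin m) (Fin n) ℤ)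
    (blk : Fin m → Fin p)
    (z ω : Fin n → ℝ) (qv : Fin (n + p) → ℝ) (κ : Fin m → ℝ) (K : ℝ)
    (hline : ∀ x y, x ∈ Eset Γ A κ → y ∈ Eset Γ A κ →
      ∃ t : ℝ, ∀ i, y i = x i * Real.exp (qv (Fin.castAdd p i) * t))
    (hder : ∀ x ∈ Eset Γ A κ, nondegAt Γ A κ x → ∑ i, ω i * x i * qv (Fin.castAdd p i) ≠ 0)
    (hdot : ∀ x y, z ⬝ᵥ y = z ⬝ᵥ x → ω ⬝ᵥ y = ω ⬝ᵥ x) (hω : ∀ i, 0 ≤ ω i)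
    (T : Finset (Fin n → ℝ))
    (hT : ↑T ⊆ {x | x ∈ Eset Γ A κ ∧ z ⬝ᵥ x = K ∧ nondegAt Γ A κ x}) : T.card ≤ 2 := by
  by_contra hcard
  push Not at hcard
  obtain ⟨a, ha, b, hb, c, hc, hab, hac, hbc⟩ := Finset.two_lt_card.1 hcard
  have tang : ∀ x ∈ T, ∀ y ∈ T, ∀ t : ℝ,
      (∀ i, y i = x i * Real.exp (qv (Fin.castAdd p i) * t)) →
      t * ∑ i, ω i * x i * qv (Fin.castAdd p i) ≤ 0 := by
    intro x hx y hy t ht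
    obtain ⟨hxE, hxK, hxn⟩ := hT hx
    obtain ⟨hyE, hyK, hyn⟩ := hT hy
    exact tangent_le ω x y _ t hω hxE.1 ht (hdot x y (hyK.trans hxK.symm))
  obtain ⟨s, hs⟩ := hline a b (hT ha).1 (hT hb).1
  obtain ⟨u, hu⟩ := hline a c (hT ha).1 (hT hc).1
  have hs0 : s ≠ 0 := by
    rintro rfl; apply hab; ext i; rw [hs i]; simp
  have hu0 : u ≠ 0 := by
    rintro rfl; apply hac; ext i; rw [hu i]; simp
  have hsu : s ≠ u := by
    rintro rfl; apply hbc; ext i; rw [hs i, hu i]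
  -- no element of `T` lies strictly between two others
  have nb : ∀ x ∈ T, ∀ y ∈ T, ∀ w ∈ T, ∀ t r : ℝ,
      (∀ i, y i = x i * Real.exp (qv (Fin.castAdd p i) * t)) →
      (∀ i, w i = x i * Real.exp (qv (Fin.castAdd p i) * r)) → 0 < t → r < 0 → False := by
    intro x hx y hy w hw t r h1 h2 ht hr
    have h3 := tang x hx y hy t h1
    have h4 := tang x hx w hw r h2
    apply hder x (hT hx).1 (hT hx).2.2
    nlinarith
  have inv : ∀ (x y : Fin n → ℝ) (t : ℝ), (∀ i, y i = x i * Real.exp (qv (Fin.castAdd p i) * t)) →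
      ∀ i, x i = y i * Real.exp (qv (Fin.castAdd p i) * (-t)) := by
    intro x y t h i
    rw [h i, mul_assoc, ← Real.exp_add]
    simp
  have sub : ∀ (x y w : Fin n → ℝ) (t r : ℝ),
      (∀ i, y i = x i * Real.exp (qv (Fin.castAdd p i) * t)) →
      (∀ i, w i = x i * Real.exp (qv (Fin.castAdd p i) * r)) →
      ∀ i, w i = y i * Real.exp (qv (Fin.castAdd p i) * (r - t)) := by
    intro x y w t r h h' i
    rw [h i, h' i, mul_assoc, ← Real.exp_add]
    congr 2
    ring
  have hbc' := sub a b c s u hs hu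
  have hcb' := sub a c b u s hu hs
  have hba := inv a b s hs
  have hca := inv a c u hu
  rcases lt_or_gt_of_ne hs0 with h1 | h1 <;> rcases lt_or_gt_of_ne hu0 with h2 | h2 <;>
    rcases lt_or_gt_of_ne hsu with h3 | h3
  · exact nb c hc a ha b hb _ _ hca hcb' (by linarith) (by linarith)
  · exact nb b hb a ha c hc _ _ hba hbc' (by linarith) (by linarith)
  · exact nb a ha c hc b hb _ _ hu hs h2 h1
  · linarith
  · linarith
  · exact nb a ha b hb c hc _ _ hs hu h1 h2
  · exact nb b hb c hc a ha _ _ hbc' hba (by linarith) (by linarith)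
  · exact nb c hc b hb a ha _ _ hcb' hca (by linarith) (by linarith)

/-- Theorem `thmnnn1`: for a dynamically nontrivial `(n,m,n−1)`
network which is not `P_f`-overdetermined and with `n ≤ m ≤ n + p_f − 1`:
`p_f = m − n + 1`, `s_{P_f} = n − 1` and `rank [A|1_{P_f}] = m`; moreover
(i) at most `n` nondegenerate positive equilibria on each stoichiometric class;
(ii) at most `2` if `ker Γᵀ ∩ ℝ^n_{≥0} \ {0} ≠ ∅`; (iii) at most `1` if in addition
a kernel vector `Q̂` of `[A|1_{P_f}]` can be chosen nonnegative on the support of `ω`. -/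
theorem statement12 {n m pf : ℕ}
    (Γ : Matrix (Fin n) (Fin m) ℤ) (A : Matrix (Fin m) (Fin n) ℤ)
    (hA : ∀ i j, 0 ≤ A i j)
    (hdyn : dynNontrivial Γ)
    (hrank : (mR Γ).rank + 1 = n)
    (blk : Fin m → Fin pf) (hblk : Function.Surjective blk) (hfac : factorsOver Γ blk)
    (hfund : ∀ (p' : ℕ) (blk' : Fin m → Fin p'), Function.Surjective blk' →
      factorsOver Γ blk' → ∀ j k, blk j = blk k → blk' j = blk' k)
    (hnod : (mR Γ).rank + pf ≤ (srcMat A blk).rank)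
    (hm1 : n ≤ m) (hm2 : m + 1 ≤ n + pf)
    (z : Fin n → ℝ) (hz : Matrix.vecMul z (mR Γ) = 0) (hz0 : z ≠ 0) :
    pf + n = m + 1 ∧
    (srcMat A blk).rank + 1 = n + pf ∧
    (srcMat A blk).rank = m ∧
    (∀ κ ∈ posOrth m, ∀ K : ℝ, ∀ T : Finset (Fin n → ℝ),
        ↑T ⊆ {x | x ∈ Eset Γ A κ ∧ z ⬝ᵥ x = K ∧ nondegAt Γ A κ x} → T.card ≤ n) ∧
    ((∃ ω : Fin n → ℝ, Matrix.vecMul ω (mR Γ) = 0 ∧ (∀ i, 0 ≤ ω i) ∧ ω ≠ 0) →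
      ∀ κ ∈ posOrth m, ∀ K : ℝ, ∀ T : Finset (Fin n → ℝ),
        ↑T ⊆ {x | x ∈ Eset Γ A κ ∧ z ⬝ᵥ x = K ∧ nondegAt Γ A κ x} → T.card ≤ 2) ∧
    ((∃ ω : Fin n → ℝ, Matrix.vecMul ω (mR Γ) = 0 ∧ (∀ i, 0 ≤ ω i) ∧ ω ≠ 0 ∧
        ∃ qv : Fin (n + pf) → ℝ, (srcMat A blk).mulVec qv = 0 ∧ qv ≠ 0 ∧
          ∀ i : Fin n, ω i ≠ 0 → 0 ≤ qv (Fin.castAdd pf i)) →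
      ∀ κ ∈ posOrth m, ∀ K : ℝ, ∀ T : Finset (Fin n → ℝ),
        ↑T ⊆ {x | x ∈ Eset Γ A κ ∧ z ⬝ᵥ x = K ∧ nondegAt Γ A κ x} → T.card ≤ 1) := by
  have hle : (srcMat A blk).rank ≤ m := by
    simpa using (srcMat A blk).rank_le_height
  have h1 : pf + n = m + 1 := by omega
  have h2 : (srcMat A blk).rank + 1 = n + pf := by omega
  have h3 : (srcMat A blk).rank = m := by omega
  have hdim : (mR Γ).rank + pf = m := by omega
  obtain ⟨q, hq, hq0⟩ : ∃ q, (srcMat A blk).mulVec q = 0 ∧ q ≠ 0 := by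
    have h5 := LinearMap.finrank_range_add_finrank_ker (srcMat A blk).mulVecLin
    have h6 : Module.finrank ℝ (LinearMap.range (srcMat A blk).mulVecLin)
      = (srcMat A blk).rank := rfl
    rw [Module.finrank_fin_fun] at h5
    have h7 : 0 < Module.finrank ℝ (LinearMap.ker (srcMat A blk).mulVecLin) := by omega
    obtain ⟨v, hv⟩ := (Module.finrank_pos_iff_exists_ne_zero).1 h7
    exact ⟨v.1, v.2, fun h => hv (Subtype.ext h)⟩
  refine ⟨h1, h2, h3, ?_, ?_, ?_⟩
  · intro κ hκ K T hT
    exact part_i Γ A blk z q κ K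
      (fun x y hx hy => equil_line Γ A blk hblk hdim hfac h2 q hq hq0 κ hκ x y hx hy)
      (fun x hx hn => nondeg_deriv Γ A blk hblk hrank hfac q hq hq0 κ x hx hn z hz hz0) T hT
  · rintro ⟨ω, hω, hωn, hω0⟩ κ hκ K T hT
    exact part_ii Γ A blk z ω q κ K
      (fun x y hx hy => equil_line Γ A blk hblk hdim hfac h2 q hq hq0 κ hκ x y hx hy)
      (fun x hx hn => nondeg_deriv Γ A blk hblk hrank hfac q hq hq0 κ x hx hn ω hω hω0)
      (dot_eq Γ hrank z ω hz hz0 hω) hωn T hT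
  · rintro ⟨ω, hω, hωn, hω0, qv, hqv, hqv0, hsgn⟩ κ hκ K T hT
    exact part_iii Γ A blk z ω qv κ K
      (fun x y hx hy => equil_line Γ A blk hblk hdim hfac h2 qv hqv hqv0 κ hκ x y hx hy)
      (fun x hx hn => nondeg_deriv Γ A blk hblk hrank hfac qv hqv hqv0 κ x hx hn ω hω hω0)
      (dot_eq Γ hrank z ω hz hz0 hω) hωn hsgn T hT

end
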